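/- Let K ≥ 1, let a : Fin K → ℝ, and let w : Fin K → ℝ with w k ≥ 0 for all k and ∑_k w k = 1. For r ∈ (0,1] define O_r(a) = max{ (1/r) ∑_k λ_k · a k : 0 ≤ λ_k ≤ w k for all k, ∑_k λ_k = r }. Then O_r(a) is nonincreasing in r: if 0 < r ≤ r' ≤ 1 then O_{r'}(a) ≤ O_r(a). -/

import Mathlib

/-- The r-OWA is nonincreasing in r. -/
theorem rOWA_antitone_in_r
    (K : ℕ) (hK : 1 ≤ K) (a w : Fin K → ℝ)
    (hw0 : ∀ k, 0 ≤ w k) (hw1 : ∑ k, w k = 1)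
    (O : ℝ → ℝ)
    (hO : O = fun r => sSup {s : ℝ | ∃ lam : Fin K → ℝ,
      (∀ k, 0 ≤ lam k ∧ lam k ≤ w k) ∧ (∑ k, lam k = r) ∧
      s = (1 / r) * ∑ k, lam k * a k}) :
    ∀ r r' : ℝ, 0 < r → r ≤ r' → r' ≤ 1 → O r' ≤ O r := by
  intro r r' hr hrr' hr'
  have hr'0 : 0 < r' := hr.trans_le hrr'
  subst hO
  apply csSup_le_csSup
  · refine ⟨(1 / r) * ∑ k, w k * |a k|, ?_⟩
    rintro s ⟨lam, hlam, -, rfl⟩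
    refine mul_le_mul_of_nonneg_left (Finset.sum_le_sum fun k _ => ?_) (by positivity)
    calc lam k * a k ≤ lam k * |a k| :=
          mul_le_mul_of_nonneg_left (le_abs_self _) (hlam k).1
      _ ≤ w k * |a k| := mul_le_mul_of_nonneg_right (hlam k).2 (abs_nonneg _)
  · refine ⟨_, fun k => r' * w k, fun k => ⟨mul_nonneg hr'0.le (hw0 k),
      mul_le_of_le_one_left (hw0 k) hr'⟩, ?_, rfl⟩
    rw [← Finset.mul_sum, hw1, mul_one]
  · rintro s ⟨lam, hlam, hsum, rfl⟩
    refine ⟨fun k => r / r' * lam k, fun k => ⟨mul_nonneg (by positivity) (hlam k).1,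
      (mul_le_of_le_one_left (hlam k).1 ((div_le_one hr'0).2 hrr')).trans (hlam k).2⟩, ?_, ?_⟩
    · rw [← Finset.mul_sum, hsum, div_mul_cancel₀ _ hr'0.ne']
    · simp_rw [mul_assoc]
      rw [← Finset.mul_sum]
      field_simp
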